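/- Let N ≥ 3 be an integer, C_N = (N(N−2))^{(N−2)/4}, and U_{0,1}(y) = C_N (1+|y|²)^{−(N−2)/2}. Suppose ξ : ℝ^N → ℝ is twice continuously differentiable, bounded, and satisfies −Δξ(y) = ((N+2)/(N−2)) U_{0,1}(y)^{4/(N−2)} ξ(y) for all y ∈ ℝ^N. Then there exist real constants c_0, c_1, …, c_N such that ξ = c_0 ψ_0 + Σ_{i=1}^N c_i ψ_i, where ψ_0(y) = ((N−2)/2) C_N (1−|y|²)(1+|y|²)^{−N/2} and ψ_i(y) = (N−2) C_N y_i (1+|y|²)^{−N/2} for i ∈ {1,…,N}. -/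

import Mathlib

open MeasureTheory Metric Real

/-- The Euclidean Laplacian `Δu = Σ_{i=1}^N ∂²u/∂y_i²` on `ℝ^N`. -/
noncomputable def laplacian {N : ℕ} (u : EuclideanSpace ℝ (Fin N) → ℝ)
    (x : EuclideanSpace ℝ (Fin N)) : ℝ :=
  ∑ i : Fin N, fderiv ℝ (fun y => fderiv ℝ u y (EuclideanSpace.single i 1)) x
    (EuclideanSpace.single i 1)

/-- The constant `C_N = (N(N-2))^{(N-2)/4}`. -/
noncomputable def bubbleConst (N : ℕ) : ℝ :=
  ((N : ℝ) * ((N : ℝ) - 2)) ^ (((N : ℝ) - 2) / 4)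

/-- The standard bubble `U_{0,1}(y) = C_N (1 + |y|²)^{-(N-2)/2}`. -/
noncomputable def U01 (N : ℕ) (y : EuclideanSpace ℝ (Fin N)) : ℝ :=
  bubbleConst N * (1 + ‖y‖ ^ 2) ^ (-(((N : ℝ) - 2) / 2))

/-- `ψ₀(y) = ((N-2)/2) C_N (1-|y|²)(1+|y|²)^{-N/2}`. -/
noncomputable def psi0 (N : ℕ) (y : EuclideanSpace ℝ (Fin N)) : ℝ :=
  (((N : ℝ) - 2) / 2) * bubbleConst N * (1 - ‖y‖ ^ 2) * (1 + ‖y‖ ^ 2) ^ (-((N : ℝ) / 2))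

/-- `ψ_i(y) = (N-2) C_N y_i (1+|y|²)^{-N/2}`. -/
noncomputable def psii (N : ℕ) (i : Fin N) (y : EuclideanSpace ℝ (Fin N)) : ℝ :=
  ((N : ℝ) - 2) * bubbleConst N * y i * (1 + ‖y‖ ^ 2) ^ (-((N : ℝ) / 2))

open MvPolynomial Filter Topology

/-! ### Partial derivatives and the Laplacian -/

section PartialDerivatives

variable {N : ℕ}

/-- The `i`-th partial derivative of a function on `ℝ^N`. -/
noncomputable def partialDeriv (i : Fin N) (f : EuclideanSpace ℝ (Fin N) → ℝ)
    (y : EuclideanSpace ℝ (Fin N)) : ℝ :=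
  fderiv ℝ f y (EuclideanSpace.single i 1)

theorem laplacian_eq_sum_partialDeriv (f : EuclideanSpace ℝ (Fin N) → ℝ)
    (y : EuclideanSpace ℝ (Fin N)) :
    laplacian f y = ∑ i, partialDeriv i (partialDeriv i f) y := rfl

theorem ContDiff.partialDeriv {f : EuclideanSpace ℝ (Fin N) → ℝ} {n m : WithTop ℕ∞}
    (hf : ContDiff ℝ n f) (hmn : m + 1 ≤ n) (i : Fin N) : ContDiff ℝ m (partialDeriv i f) :=
  (hf.fderiv_right hmn).clm_apply contDiff_const

theorem ContDiff.partialDeriv_one {f : EuclideanSpace ℝ (Fin N) → ℝ}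
    (hf : ContDiff ℝ 2 f) (i : Fin N) : ContDiff ℝ 1 (_root_.partialDeriv i f) :=
  hf.partialDeriv (by norm_num) i

theorem ContDiff.continuous_partialDeriv {f : EuclideanSpace ℝ (Fin N) → ℝ}
    (hf : ContDiff ℝ 1 f) (i : Fin N) : Continuous (_root_.partialDeriv i f) :=
  (hf.partialDeriv (m := 0) (by norm_num) i).continuous

theorem ContDiff.continuous_laplacian {f : EuclideanSpace ℝ (Fin N) → ℝ}
    (hf : ContDiff ℝ 2 f) : Continuous (laplacian f) :=
  continuous_finsetSum _ fun i _ => (hf.partialDeriv_one i).continuous_partialDeriv i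

theorem partialDeriv_mul {f g : EuclideanSpace ℝ (Fin N) → ℝ} (hf : Differentiable ℝ f)
    (hg : Differentiable ℝ g) (i : Fin N) :
    partialDeriv i (fun y => f y * g y) =
      fun y => f y * partialDeriv i g y + partialDeriv i f y * g y := by
  funext y
  simp only [partialDeriv]
  rw [fderiv_fun_mul (hf y) (hg y)]
  simp [mul_comm]

theorem partialDeriv_add {f g : EuclideanSpace ℝ (Fin N) → ℝ} (hf : Differentiable ℝ f)
    (hg : Differentiable ℝ g) (i : Fin N) :
    partialDeriv i (fun y => f y + g y) =
      fun y => partialDeriv i f y + partialDeriv i g y := by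
  funext y
  simp only [partialDeriv]
  rw [fderiv_fun_add (hf y) (hg y)]
  simp

theorem partialDeriv_const_mul {f : EuclideanSpace ℝ (Fin N) → ℝ} (hf : Differentiable ℝ f)
    (c : ℝ) (i : Fin N) :
    partialDeriv i (fun y => c * f y) = fun y => c * partialDeriv i f y := by
  funext y
  simp only [partialDeriv]
  rw [fderiv_const_mul (hf y)]
  simp

theorem laplacian_mul {f g : EuclideanSpace ℝ (Fin N) → ℝ} (hf : ContDiff ℝ 2 f)
    (hg : ContDiff ℝ 2 g) (y : EuclideanSpace ℝ (Fin N)) :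
    laplacian (fun y => f y * g y) y =
      f y * laplacian g y + 2 * ∑ i, partialDeriv i f y * partialDeriv i g y
        + laplacian f y * g y := by
  simp only [laplacian_eq_sum_partialDeriv, Finset.mul_sum, Finset.sum_mul,
    ← Finset.sum_add_distrib]
  refine Finset.sum_congr rfl fun i _ => ?_
  have hf1 := hf.differentiable (by norm_num)
  have hg1 := hg.differentiable (by norm_num)
  have hf2 := (hf.partialDeriv_one i).differentiable (by norm_num)
  have hg2 := (hg.partialDeriv_one i).differentiable (by norm_num)
  rw [partialDeriv_mul hf1 hg1, partialDeriv_add (hf1.fun_mul hg2) (hf2.fun_mul hg1),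
    partialDeriv_mul hf1 hg2, partialDeriv_mul hf2 hg1]
  ring

theorem laplacian_add {f g : EuclideanSpace ℝ (Fin N) → ℝ} (hf : ContDiff ℝ 2 f)
    (hg : ContDiff ℝ 2 g) (y : EuclideanSpace ℝ (Fin N)) :
    laplacian (fun y => f y + g y) y = laplacian f y + laplacian g y := by
  simp only [laplacian_eq_sum_partialDeriv, ← Finset.sum_add_distrib]
  refine Finset.sum_congr rfl fun i _ => ?_
  rw [partialDeriv_add (hf.differentiable (by norm_num)) (hg.differentiable (by norm_num)),
    partialDeriv_add ((hf.partialDeriv_one i).differentiable (by norm_num))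
      ((hg.partialDeriv_one i).differentiable (by norm_num))]

theorem laplacian_const_mul {f : EuclideanSpace ℝ (Fin N) → ℝ} (hf : ContDiff ℝ 2 f) (c : ℝ)
    (y : EuclideanSpace ℝ (Fin N)) :
    laplacian (fun y => c * f y) y = c * laplacian f y := by
  simp only [laplacian_eq_sum_partialDeriv, Finset.mul_sum]
  refine Finset.sum_congr rfl fun i _ => ?_
  rw [partialDeriv_const_mul (hf.differentiable (by norm_num)),
    partialDeriv_const_mul ((hf.partialDeriv_one i).differentiable (by norm_num))]

theorem HasCompactSupport.partialDeriv {f : EuclideanSpace ℝ (Fin N) → ℝ}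
    (hf : HasCompactSupport f) (i : Fin N) : HasCompactSupport (partialDeriv i f) :=
  hf.fderiv_apply (𝕜 := ℝ) _

theorem HasCompactSupport.laplacian {f : EuclideanSpace ℝ (Fin N) → ℝ}
    (hf : HasCompactSupport f) : HasCompactSupport (laplacian f) := by
  refine HasCompactSupport.intro hf.isCompact fun y hy => ?_
  rw [laplacian_eq_sum_partialDeriv]
  refine Finset.sum_eq_zero fun i _ => image_eq_zero_of_notMem_tsupport fun hy' => hy ?_
  exact tsupport_fderiv_apply_subset ℝ _ (tsupport_fderiv_apply_subset ℝ _ hy')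

theorem integral_mul_partialDeriv {f g : EuclideanSpace ℝ (Fin N) → ℝ}
    (hf : ContDiff ℝ 1 f) (hg : ContDiff ℝ 1 g) (hc : HasCompactSupport g) (i : Fin N) :
    ∫ y, f y * partialDeriv i g y = -∫ y, partialDeriv i f y * g y := by
  refine integral_mul_fderiv_eq_neg_fderiv_mul_of_integrable ?_ ?_ ?_
    (fun x _ => hf.differentiable (by norm_num) x)
    (fun x _ => hg.differentiable (by norm_num) x)
  · exact ((hf.continuous_partialDeriv i).mul hg.continuous).integrable_of_hasCompactSupport
      hc.mul_left
  · exact (hf.continuous.mul (hg.continuous_partialDeriv i)).integrable_of_hasCompactSupport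
      (hc.partialDeriv i).mul_left
  · exact (hf.continuous.mul hg.continuous).integrable_of_hasCompactSupport hc.mul_left

/-- Green's second identity when one of the functions has compact support. -/
theorem integral_mul_laplacian_of_hasCompactSupport {f g : EuclideanSpace ℝ (Fin N) → ℝ}
    (hf : ContDiff ℝ 2 f) (hg : ContDiff ℝ 2 g) (hc : HasCompactSupport g) :
    ∫ y, f y * laplacian g y = ∫ y, laplacian f y * g y := by
  have hf1 : ContDiff ℝ 1 f := hf.of_le (by norm_num)
  have hg1 : ContDiff ℝ 1 g := hg.of_le (by norm_num)
  simp only [laplacian_eq_sum_partialDeriv, Finset.mul_sum, Finset.sum_mul]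
  rw [integral_finsetSum, integral_finsetSum]
  · refine Finset.sum_congr rfl fun i _ => ?_
    rw [integral_mul_partialDeriv hf1 (hg.partialDeriv_one i) (hc.partialDeriv i),
      integral_mul_partialDeriv (hf.partialDeriv_one i) hg1 hc, neg_neg]
  · intro i _
    exact (((hf.partialDeriv_one i).continuous_partialDeriv i).mul
      hg.continuous).integrable_of_hasCompactSupport hc.mul_left
  · intro i _
    exact (hf.continuous.mul ((hg.partialDeriv_one i).continuous_partialDeriv
      i)).integrable_of_hasCompactSupport ((hc.partialDeriv i).partialDeriv i).mul_left

end PartialDerivatives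

/-! ### Powers of `1 + |y|²` and polynomials -/

section Bracket

variable {N : ℕ}

/-- The function `(1 + |y|²)^{-β}`. -/
noncomputable def bracketPow (β : ℝ) (y : EuclideanSpace ℝ (Fin N)) : ℝ :=
  (1 + ‖y‖ ^ 2) ^ (-β)

theorem one_add_norm_sq_pos (y : EuclideanSpace ℝ (Fin N)) : 0 < 1 + ‖y‖ ^ 2 := by positivity

theorem bracketPow_pos (β : ℝ) (y : EuclideanSpace ℝ (Fin N)) : 0 < bracketPow β y :=
  rpow_pos_of_pos (one_add_norm_sq_pos y) _

theorem bracketPow_zero (y : EuclideanSpace ℝ (Fin N)) : bracketPow 0 y = 1 := by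
  simp [bracketPow]

theorem bracketPow_add (a b : ℝ) (y : EuclideanSpace ℝ (Fin N)) :
    bracketPow (a + b) y = bracketPow a y * bracketPow b y := by
  rw [bracketPow, neg_add, rpow_add (one_add_norm_sq_pos y)]
  rfl

theorem bracketPow_mul_bracketPow {a b c : ℝ} (h : a + b = c) (y : EuclideanSpace ℝ (Fin N)) :
    bracketPow a y * bracketPow b y = bracketPow c y := by
  rw [← h, bracketPow_add]

theorem bracketPow_one_mul (y : EuclideanSpace ℝ (Fin N)) :
    bracketPow 1 y * (1 + ‖y‖ ^ 2) = 1 := by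
  rw [bracketPow, rpow_neg_one, inv_mul_cancel₀ (one_add_norm_sq_pos y).ne']

theorem bracketPow_le {a b : ℝ} (h : a ≤ b) (y : EuclideanSpace ℝ (Fin N)) :
    bracketPow b y ≤ bracketPow a y :=
  rpow_le_rpow_of_exponent_le (by nlinarith [sq_nonneg ‖y‖]) (by linarith)

theorem bracketPow_le_one {a : ℝ} (h : 0 ≤ a) (y : EuclideanSpace ℝ (Fin N)) :
    bracketPow a y ≤ 1 :=
  (bracketPow_le h y).trans_eq (bracketPow_zero y)

theorem abs_coord_le_bracketPow (y : EuclideanSpace ℝ (Fin N)) (i : Fin N) :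
    |y i| ≤ bracketPow (-(1 / 2)) y := by
  have h : ‖y i‖ ≤ ‖y‖ := PiLp.norm_apply_le y i
  rw [bracketPow, neg_neg, ← sqrt_eq_rpow]
  refine le_sqrt_of_sq_le ?_
  rw [Real.norm_eq_abs] at h
  nlinarith [abs_nonneg (y i)]

theorem contDiff_bracketPow {n : WithTop ℕ∞} (β : ℝ) :
    ContDiff ℝ n (bracketPow β : EuclideanSpace ℝ (Fin N) → ℝ) :=
  (contDiff_const.add (contDiff_norm_sq ℝ)).rpow_const_of_ne
    fun y => (one_add_norm_sq_pos y).ne'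

theorem partialDeriv_bracketPow (β : ℝ) (i : Fin N) :
    partialDeriv i (bracketPow β : EuclideanSpace ℝ (Fin N) → ℝ) =
      fun y => -(2 * β) * (y i * bracketPow (β + 1) y) := by
  funext y
  have h1 : HasFDerivAt (fun y : EuclideanSpace ℝ (Fin N) => 1 + ‖y‖ ^ 2)
      (2 • innerSL ℝ y) y := (hasStrictFDerivAt_norm_sq y).hasFDerivAt.const_add 1
  have h2 := h1.rpow_const (p := -β) (Or.inl (one_add_norm_sq_pos y).ne')
  have h3 : partialDeriv i (bracketPow β) y = _ :=
    congrArg (fun L => L (EuclideanSpace.single i 1)) h2.fderiv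
  rw [h3]
  have h4 : -β - 1 = -(β + 1) := by ring
  simp [bracketPow, EuclideanSpace.inner_single_right, h4]
  ring

theorem integrable_bracketPow {β : ℝ} (h : (N : ℝ) < 2 * β) :
    Integrable (bracketPow β : EuclideanSpace ℝ (Fin N) → ℝ) := by
  have := integrable_rpow_neg_one_add_norm_sq (E := EuclideanSpace ℝ (Fin N))
    (μ := volume) (r := 2 * β) (by simpa using h)
  refine this.congr (Eventually.of_forall fun y => ?_)
  simp only [bracketPow]
  congr 1
  ring

/-- Evaluation of a polynomial in the coordinates of a point of `ℝ^N`. -/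
noncomputable def polyEval (p : MvPolynomial (Fin N) ℝ) (y : EuclideanSpace ℝ (Fin N)) : ℝ :=
  eval (fun i => y i) p

theorem contDiff_coord {n : WithTop ℕ∞} (i : Fin N) :
    ContDiff ℝ n (fun y : EuclideanSpace ℝ (Fin N) => y i) :=
  (EuclideanSpace.proj i : EuclideanSpace ℝ (Fin N) →L[ℝ] ℝ).contDiff

theorem contDiff_polyEval {n : WithTop ℕ∞} (p : MvPolynomial (Fin N) ℝ) :
    ContDiff ℝ n (polyEval p) := by
  unfold polyEval
  induction p using MvPolynomial.induction_on with
  | C a => simpa using contDiff_const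
  | add p q hp hq => simpa using hp.add hq
  | mul_X p i hp => simpa using hp.mul (contDiff_coord i)

theorem partialDeriv_coord (i j : Fin N) :
    partialDeriv i (fun y : EuclideanSpace ℝ (Fin N) => y j) =
      fun _ => if j = i then 1 else 0 := by
  funext y
  have h := (EuclideanSpace.proj j : EuclideanSpace ℝ (Fin N) →L[ℝ] ℝ).hasFDerivAt (x := y)
  have h3 : partialDeriv i (fun y : EuclideanSpace ℝ (Fin N) => y j) y = _ :=
    congrArg (fun L => L (EuclideanSpace.single i 1)) h.fderiv
  rw [h3]
  simp

theorem partialDeriv_polyEval (p : MvPolynomial (Fin N) ℝ) (i : Fin N) :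
    partialDeriv i (polyEval p) = polyEval (pderiv i p) := by
  induction p using MvPolynomial.induction_on with
  | C a =>
    funext y
    have : (polyEval (C a) : EuclideanSpace ℝ (Fin N) → ℝ) = fun _ => a := by
      funext; simp [polyEval]
    rw [this]
    simp [partialDeriv, polyEval]
  | add p q hp hq =>
    have h := partialDeriv_add ((contDiff_polyEval p).differentiable one_ne_zero)
      ((contDiff_polyEval q).differentiable one_ne_zero) i
    have h' : polyEval (p + q) = fun y : EuclideanSpace ℝ (Fin N) => polyEval p y + polyEval q y := by
      funext; simp [polyEval]
    rw [h', h, hp, hq]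
    funext y
    simp [polyEval]
  | mul_X p j hp =>
    have h := partialDeriv_mul ((contDiff_polyEval p).differentiable one_ne_zero)
      ((contDiff_coord j).differentiable one_ne_zero) i
    have h' : polyEval (p * X j) = fun y : EuclideanSpace ℝ (Fin N) => polyEval p y * y j := by
      funext; simp [polyEval]
    rw [h', h, hp, partialDeriv_coord]
    funext y
    by_cases hij : j = i <;> simp [polyEval, pderiv_X, hij, mul_comm]

/-- The Laplacian of a polynomial, as a polynomial. -/
noncomputable def polyLaplacian (p : MvPolynomial (Fin N) ℝ) : MvPolynomial (Fin N) ℝ :=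
  ∑ i, pderiv i (pderiv i p)

theorem isHomogeneous_polyLaplacian {p : MvPolynomial (Fin N) ℝ} {k : ℕ}
    (hp : p.IsHomogeneous k) : (polyLaplacian p).IsHomogeneous (k - 2) :=
  IsHomogeneous.sum _ _ _ fun _ _ => hp.pderiv.pderiv

theorem polyLaplacian_eq_zero {p : MvPolynomial (Fin N) ℝ} {k : ℕ}
    (hp : p.IsHomogeneous k) (hk : k ≤ 1) : polyLaplacian p = 0 := by
  refine Finset.sum_eq_zero fun i _ => ?_
  have h : (pderiv i p).IsHomogeneous 0 := by
    simpa [Nat.sub_eq_zero_of_le hk] using hp.pderiv (i := i)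
  rw [totalDegree_eq_zero_iff_eq_C.1 ((totalDegree_zero_iff_isHomogeneous _).2 h), pderiv_C]

theorem laplacian_polyEval (p : MvPolynomial (Fin N) ℝ) (y : EuclideanSpace ℝ (Fin N)) :
    laplacian (polyEval p) y = polyEval (polyLaplacian p) y := by
  simp [laplacian_eq_sum_partialDeriv, partialDeriv_polyEval, polyLaplacian, polyEval]

theorem sum_coord_mul_partialDeriv_polyEval {p : MvPolynomial (Fin N) ℝ} {k : ℕ}
    (hp : p.IsHomogeneous k) (y : EuclideanSpace ℝ (Fin N)) :
    ∑ i, y i * partialDeriv i (polyEval p) y = k * polyEval p y := by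
  have h := congrArg (fun q => polyEval q y) hp.sum_X_mul_pderiv
  simpa [partialDeriv_polyEval, polyEval] using h

theorem exists_abs_polyEval_le {p : MvPolynomial (Fin N) ℝ} {k : ℕ} (hp : p.IsHomogeneous k) :
    ∃ C, 0 ≤ C ∧ ∀ y : EuclideanSpace ℝ (Fin N),
      |polyEval p y| ≤ C * bracketPow (-((k : ℝ) / 2)) y := by
  refine ⟨∑ d ∈ p.support, |coeff d p|, Finset.sum_nonneg fun _ _ => abs_nonneg _, fun y => ?_⟩
  rw [polyEval, eval_eq', Finset.sum_mul]
  refine (Finset.abs_sum_le_sum_abs _ _).trans (Finset.sum_le_sum fun d hd => ?_)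
  rw [abs_mul, Finset.abs_prod]
  refine mul_le_mul_of_nonneg_left ?_ (abs_nonneg _)
  have hdeg : ∑ i, d i = k := by
    rw [← hp (mem_support_iff.1 hd), Finsupp.weight_apply, Finsupp.sum_fintype _ _ (by simp)]
    simp
  calc ∏ i, |y i ^ d i| ≤ ∏ i, bracketPow (-(1 / 2)) y ^ d i := by
        refine Finset.prod_le_prod (fun _ _ => abs_nonneg _) fun i _ => ?_
        rw [abs_pow]
        exact pow_le_pow_left₀ (abs_nonneg _) (abs_coord_le_bracketPow y i) _
    _ = bracketPow (-((k : ℝ) / 2)) y := by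
        rw [Finset.prod_pow_eq_pow_sum, hdeg, bracketPow, bracketPow,
          ← rpow_mul_natCast (one_add_norm_sq_pos y).le]
        congr 1
        ring

theorem laplacian_bracketPow (β : ℝ) (y : EuclideanSpace ℝ (Fin N)) :
    laplacian (bracketPow β) y = -(2 * β * N) * bracketPow (β + 1) y
      + 4 * β * (β + 1) * (bracketPow (β + 1) y - bracketPow (β + 2) y) := by
  have hnorm : ∑ i, y i ^ 2 = ‖y‖ ^ 2 := by rw [EuclideanSpace.real_norm_sq_eq]
  have hsq : bracketPow (β + 2) y * (1 + ‖y‖ ^ 2) = bracketPow (β + 1) y := by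
    rw [← bracketPow_mul_bracketPow (show β + 1 + 1 = β + 2 by ring), mul_assoc,
      bracketPow_one_mul, mul_one]
  have h : ∀ i, partialDeriv i (partialDeriv i (bracketPow β)) y =
      -(2 * β) * bracketPow (β + 1) y + 4 * β * (β + 1) * bracketPow (β + 2) y * y i ^ 2 := by
    intro i
    rw [partialDeriv_bracketPow,
      partialDeriv_const_mul (((contDiff_coord i).mul
        (contDiff_bracketPow _)).differentiable one_ne_zero),
      partialDeriv_mul ((contDiff_coord i).differentiable one_ne_zero)
        ((contDiff_bracketPow _).differentiable one_ne_zero),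
      partialDeriv_coord, partialDeriv_bracketPow, show β + 1 + 1 = β + 2 by ring]
    simp only [if_true]
    ring
  simp only [laplacian_eq_sum_partialDeriv, h, Finset.sum_add_distrib, ← Finset.mul_sum, hnorm]
  simp only [Finset.sum_const, Finset.card_univ, Fintype.card_fin, nsmul_eq_mul]
  linear_combination 4 * β * (β + 1) * hsq

theorem laplacian_bracketPow_mul_polyEval {p : MvPolynomial (Fin N) ℝ} {k : ℕ}
    (hp : p.IsHomogeneous k) (β : ℝ) (y : EuclideanSpace ℝ (Fin N)) :
    laplacian (fun y => bracketPow β y * polyEval p y) y =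
      4 * β * (β + 1 - N / 2 - k) * (bracketPow (β + 1) y * polyEval p y)
        - 4 * β * (β + 1) * (bracketPow (β + 2) y * polyEval p y)
        + bracketPow β y * polyEval (polyLaplacian p) y := by
  rw [laplacian_mul (contDiff_bracketPow β) (contDiff_polyEval p), laplacian_bracketPow,
    laplacian_polyEval]
  have h : ∑ i, partialDeriv i (bracketPow β) y * partialDeriv i (polyEval p) y =
      -(2 * β) * bracketPow (β + 1) y * (k * polyEval p y) := by
    rw [← sum_coord_mul_partialDeriv_polyEval hp, Finset.mul_sum]
    refine Finset.sum_congr rfl fun i _ => ?_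
    rw [partialDeriv_bracketPow]
    ring
  rw [h]
  ring

end Bracket

/-! ### Green's identity for decaying functions -/

section Green

variable {N : ℕ}

theorem partialDeriv_comp_smul (f : EuclideanSpace ℝ (Fin N) → ℝ)
    (c : ℝ) (i : Fin N) :
    partialDeriv i (fun y => f (c • y)) = fun y => c * partialDeriv i f (c • y) := by
  funext y
  simp only [partialDeriv]
  rw [fderiv_comp_smul]
  simp

theorem laplacian_comp_smul {f : EuclideanSpace ℝ (Fin N) → ℝ} (hf : ContDiff ℝ 2 f)
    (c : ℝ) (y : EuclideanSpace ℝ (Fin N)) :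
    laplacian (fun y => f (c • y)) y = c ^ 2 * laplacian f (c • y) := by
  simp only [laplacian_eq_sum_partialDeriv, Finset.mul_sum]
  refine Finset.sum_congr rfl fun i _ => ?_
  have h1 : ContDiff ℝ 1 (fun y => partialDeriv i f (c • y)) :=
    (hf.partialDeriv_one i).comp (contDiff_id.const_smul c)
  rw [partialDeriv_comp_smul, partialDeriv_const_mul (h1.differentiable one_ne_zero),
    partialDeriv_comp_smul]
  ring

theorem mul_bracketPow_neg_half_le {c : ℝ} (hc0 : 0 ≤ c) (hc1 : c ≤ 1)
    (y : EuclideanSpace ℝ (Fin N)) :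
    c * bracketPow (-(1 / 2)) y ≤ bracketPow (-(1 / 2)) (c • y) := by
  simp only [bracketPow, neg_neg, ← sqrt_eq_rpow]
  refine le_sqrt_of_sq_le ?_
  rw [mul_pow, sq_sqrt (one_add_norm_sq_pos y).le, norm_smul, Real.norm_eq_abs, mul_pow, sq_abs]
  nlinarith

theorem bracketPow_neg_half_mul (y : EuclideanSpace ℝ (Fin N)) :
    bracketPow (-(1 / 2)) y * bracketPow (1 / 2) y = 1 := by
  rw [bracketPow_mul_bracketPow (show -(1 / 2) + 1 / 2 = (0 : ℝ) by ring), bracketPow_zero]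

/-- Rescaling a compactly supported function by `c ≤ 1` produces decay, uniformly in `c`. -/
theorem exists_pow_mul_abs_comp_smul_le {g : EuclideanSpace ℝ (Fin N) → ℝ}
    (hg : Continuous g) (hgc : HasCompactSupport g) (j : ℕ) :
    ∃ C, 0 ≤ C ∧ ∀ c : ℝ, 0 ≤ c → c ≤ 1 → ∀ y,
      |c ^ j * g (c • y)| ≤ C * bracketPow (1 / 2) y ^ j := by
  obtain ⟨C, hC⟩ := (hg.mul ((contDiff_bracketPow (n := 0)
    (-(1 / 2))).continuous.pow j)).bounded_above_of_compact_support hgc.mul_right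
  refine ⟨C, (norm_nonneg _).trans (hC 0), fun c hc0 hc1 y => ?_⟩
  have h1 : c ^ j * bracketPow (-(1 / 2)) y ^ j ≤ bracketPow (-(1 / 2)) (c • y) ^ j := by
    rw [← mul_pow]
    exact pow_le_pow_left₀ (mul_nonneg hc0 (bracketPow_pos _ _).le)
      (mul_bracketPow_neg_half_le hc0 hc1 y) j
  have h2 : |g (c • y)| * bracketPow (-(1 / 2)) (c • y) ^ j ≤ C := by
    have := hC (c • y)
    rwa [Pi.mul_apply, Pi.pow_apply, Real.norm_eq_abs, abs_mul,
      abs_of_pos (pow_pos (bracketPow_pos _ _) j)] at this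
  have h3 : bracketPow (-(1 / 2)) y ^ j * bracketPow (1 / 2) y ^ j = 1 := by
    rw [← mul_pow, bracketPow_neg_half_mul, one_pow]
  have h4 : 0 < bracketPow (1 / 2) y ^ j := pow_pos (bracketPow_pos _ _) j
  rw [abs_mul, abs_of_nonneg (pow_nonneg hc0 j)]
  calc c ^ j * |g (c • y)|
      = |g (c • y)| * (c ^ j * bracketPow (-(1 / 2)) y ^ j) * bracketPow (1 / 2) y ^ j := by
        linear_combination (-(c ^ j * |g (c • y)|)) * h3
    _ ≤ |g (c • y)| * bracketPow (-(1 / 2)) (c • y) ^ j * bracketPow (1 / 2) y ^ j := by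
        gcongr
    _ ≤ C * bracketPow (1 / 2) y ^ j := by gcongr

/-- A sequence of cutoff functions whose derivatives decay uniformly. -/
theorem exists_cutoff_seq (N : ℕ) :
    ∃ χ : ℕ → EuclideanSpace ℝ (Fin N) → ℝ,
      (∀ n, ContDiff ℝ 2 (χ n)) ∧ (∀ n, HasCompactSupport (χ n)) ∧
      (∀ n y, |χ n y| ≤ 1) ∧
      (∀ i, ∃ C, 0 ≤ C ∧ ∀ n y, |partialDeriv i (χ n) y| ≤ C * bracketPow (1 / 2) y) ∧
      (∃ C, 0 ≤ C ∧ ∀ n y, |laplacian (χ n) y| ≤ C * bracketPow 1 y) ∧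
      ∀ y, ∀ᶠ n in atTop,
        χ n y = 1 ∧ (∀ i, partialDeriv i (χ n) y = 0) ∧ laplacian (χ n) y = 0 := by
  let φ : ContDiffBump (0 : EuclideanSpace ℝ (Fin N)) := ⟨1, 2, one_pos, one_lt_two⟩
  have hφ : ContDiff ℝ 2 φ := φ.contDiff
  have hφc : HasCompactSupport φ := φ.hasCompactSupport
  let c : ℕ → ℝ := fun n => 1 / ((n : ℝ) + 1)
  have hc0 : ∀ n, 0 < c n := fun n => Nat.one_div_pos_of_nat
  have hc1 : ∀ n, c n ≤ 1 := fun n => by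
    refine (div_le_one (by positivity)).2 ?_
    linarith [Nat.cast_nonneg (α := ℝ) n]
  refine ⟨fun n y => φ (c n • y), fun n => hφ.comp (contDiff_id.const_smul _), fun n => ?_,
    fun n y => ?_, fun i => ?_, ?_, fun y => ?_⟩
  · exact hφc.comp_smul (hc0 n).ne'
  · rw [abs_of_nonneg φ.nonneg]
    exact φ.le_one
  · obtain ⟨C, hC0, hC⟩ := exists_pow_mul_abs_comp_smul_le
      ((hφ.partialDeriv_one i).continuous) (hφc.partialDeriv i) 1
    refine ⟨C, hC0, fun n y => ?_⟩
    rw [partialDeriv_comp_smul]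
    simpa using hC (c n) (hc0 n).le (hc1 n) y
  · obtain ⟨C, hC0, hC⟩ := exists_pow_mul_abs_comp_smul_le
      hφ.continuous_laplacian hφc.laplacian 2
    refine ⟨C, hC0, fun n y => ?_⟩
    rw [laplacian_comp_smul hφ]
    have h := hC (c n) (hc0 n).le (hc1 n) y
    rwa [sq (bracketPow (1 / 2) y),
      bracketPow_mul_bracketPow (show 1 / 2 + 1 / 2 = (1 : ℝ) by norm_num)] at h
  · have hone : (φ : EuclideanSpace ℝ (Fin N) → ℝ) =ᶠ[𝓝 0] fun _ => 1 := φ.eventuallyEq_one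
    have hd : ∀ i, partialDeriv i φ =ᶠ[𝓝 0] fun _ => 0 := fun i => by
      filter_upwards [hone.fderiv (𝕜 := ℝ)] with z hz
      simp [partialDeriv, hz]
    have hdd : ∀ i, partialDeriv i (partialDeriv i φ) =ᶠ[𝓝 0] fun _ => 0 := fun i => by
      filter_upwards [(hd i).fderiv (𝕜 := ℝ)] with z hz
      rw [partialDeriv, hz]
      simp
    have hlim : Tendsto (fun n => c n • y) atTop (𝓝 0) := by
      simpa [c] using (tendsto_one_div_add_atTop_nhds_zero_nat (𝕜 := ℝ)).smul_const y
    filter_upwards [hlim.eventually hone, hlim.eventually (eventually_all.2 hd),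
      hlim.eventually (eventually_all.2 hdd)] with n h1 h2 h3
    refine ⟨h1, fun i => ?_, ?_⟩
    · rw [partialDeriv_comp_smul]
      simp only [h2 i, mul_zero]
    · rw [laplacian_comp_smul hφ, laplacian_eq_sum_partialDeriv]
      simp [h3]

/-- Green's second identity on `ℝ^N` for a bounded function and a decaying one. -/
theorem integral_mul_laplacian_of_decay {u w : EuclideanSpace ℝ (Fin N) → ℝ} {a B C : ℝ}
    (hu : ContDiff ℝ 2 u) (hB : ∀ y, |u y| ≤ B) (hw : ContDiff ℝ 2 w)
    (hC : ∀ y, |w y| ≤ C * bracketPow a y)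
    (hD : ∀ i, ∃ D, ∀ y, |partialDeriv i w y| ≤ D * bracketPow (a + 1 / 2) y)
    (ha : (N : ℝ) < 2 * (a + 1))
    (huw : Integrable fun y => u y * laplacian w y)
    (hwu : Integrable fun y => laplacian u y * w y) :
    ∫ y, u y * laplacian w y = ∫ y, laplacian u y * w y := by
  obtain ⟨χ, hχ, hχc, hχ1, hχd, ⟨K, hK0, hK⟩, hχe⟩ := exists_cutoff_seq N
  choose E hE0 hE using hχd
  choose D hD using hD
  have hB0 : 0 ≤ B := (abs_nonneg _).trans (hB 0)
  have hleft : Tendsto (fun n => ∫ y, u y * laplacian (fun y => χ n y * w y) y) atTop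
      (𝓝 (∫ y, u y * laplacian w y)) := by
    refine tendsto_integral_of_dominated_convergence
      (fun y => |u y * laplacian w y| + B * (2 * (∑ i, E i * D i) + K * C) * bracketPow (a + 1) y)
      (fun n => (hu.continuous.mul
        ((hχ n).mul hw).continuous_laplacian).aestronglyMeasurable)
      (huw.abs.add ((integrable_bracketPow ha).const_mul _))
      (fun n => Eventually.of_forall fun y => ?_) (Eventually.of_forall fun y => ?_)
    · rw [laplacian_mul (hχ n) hw, Real.norm_eq_abs]
      have h1 : |χ n y * (u y * laplacian w y)| ≤ |u y * laplacian w y| := by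
        rw [abs_mul]
        exact mul_le_of_le_one_left (abs_nonneg _) (hχ1 n y)
      have h2 : |∑ i, partialDeriv i (χ n) y * partialDeriv i w y| ≤
          (∑ i, E i * D i) * bracketPow (a + 1) y := by
        rw [Finset.sum_mul]
        refine (Finset.abs_sum_le_sum_abs _ _).trans (Finset.sum_le_sum fun i _ => ?_)
        rw [abs_mul]
        calc |partialDeriv i (χ n) y| * |partialDeriv i w y|
            ≤ (E i * bracketPow (1 / 2) y) * (D i * bracketPow (a + 1 / 2) y) :=
              mul_le_mul (hE i n y) (hD i y) (abs_nonneg _)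
                (mul_nonneg (hE0 i) (bracketPow_pos _ _).le)
          _ = E i * D i * bracketPow (a + 1) y := by
              rw [← bracketPow_mul_bracketPow (show 1 / 2 + (a + 1 / 2) = a + 1 by ring)]
              ring
      have h3 : |laplacian (χ n) y * w y| ≤ K * C * bracketPow (a + 1) y := by
        rw [abs_mul]
        calc |laplacian (χ n) y| * |w y| ≤ (K * bracketPow 1 y) * (C * bracketPow a y) :=
              mul_le_mul (hK n y) (hC y) (abs_nonneg _)
                (mul_nonneg hK0 (bracketPow_pos _ _).le)
          _ = K * C * bracketPow (a + 1) y := by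
              rw [bracketPow_add a 1]
              ring
      have h4 : |u y * (2 * (∑ i, partialDeriv i (χ n) y * partialDeriv i w y)
          + laplacian (χ n) y * w y)| ≤
          B * (2 * (∑ i, E i * D i) + K * C) * bracketPow (a + 1) y := by
        rw [abs_mul, mul_assoc]
        refine mul_le_mul (hB y) ?_ (abs_nonneg _) hB0
        refine (abs_add_le _ _).trans ?_
        rw [abs_mul, abs_two]
        linarith
      calc |u y * (χ n y * laplacian w y
            + 2 * (∑ i, partialDeriv i (χ n) y * partialDeriv i w y) + laplacian (χ n) y * w y)|
          = |χ n y * (u y * laplacian w y)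
            + u y * (2 * (∑ i, partialDeriv i (χ n) y * partialDeriv i w y)
              + laplacian (χ n) y * w y)| := by congr 1; ring
        _ ≤ _ := (abs_add_le _ _).trans (add_le_add h1 h4)
    · refine tendsto_const_nhds.congr' ?_
      filter_upwards [hχe y] with n hn
      rw [laplacian_mul (hχ n) hw, hn.1, hn.2.2]
      simp [hn.2.1]
  have hright : Tendsto (fun n => ∫ y, laplacian u y * (χ n y * w y)) atTop
      (𝓝 (∫ y, laplacian u y * w y)) := by
    refine tendsto_integral_of_dominated_convergence (fun y => |laplacian u y * w y|)
      (fun n => (hu.continuous_laplacian.mul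
        ((hχ n).continuous.mul hw.continuous)).aestronglyMeasurable) hwu.abs
      (fun n => Eventually.of_forall fun y => ?_) (Eventually.of_forall fun y => ?_)
    · rw [Real.norm_eq_abs, mul_left_comm, abs_mul]
      exact mul_le_of_le_one_left (abs_nonneg _) (hχ1 n y)
    · refine tendsto_const_nhds.congr' ?_
      filter_upwards [hχe y] with n hn
      rw [hn.1, one_mul]
  refine tendsto_nhds_unique hleft (hright.congr fun n => ?_)
  exact (integral_mul_laplacian_of_hasCompactSupport hu ((hχ n).mul hw) (hχc n).mul_right).symm

end Green

/-! ### Functions orthogonal to a point-separating algebra -/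

section Separation

open scoped BoundedContinuousFunction

/-- An integrable function that is orthogonal to a point-separating algebra of bounded continuous
functions vanishes almost everywhere. -/
theorem ae_eq_zero_of_forall_mem_subalgebra_integral_mul_eq_zero {α : Type*} [TopologicalSpace α]
    [PolishSpace α] [MeasurableSpace α] [BorelSpace α] {μ : Measure α} {f : α → ℝ}
    (hf : Integrable f μ) (A : Subalgebra ℝ (α →ᵇ ℝ))
    (hsep : ∀ x y, x ≠ y → ∃ g ∈ A, g x ≠ g y)
    (h : ∀ g ∈ A, ∫ x, f x * g x ∂μ = 0) : f =ᵐ[μ] 0 := by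
  let B : StarSubalgebra ℝ (α →ᵇ ℝ) :=
    { A with
      star_mem' := fun {g} hg => by
        have hstar : star g = g := by ext x; simp
        rwa [hstar] }
  have hneg : AEMeasurable (fun x => -f x) μ := hf.aemeasurable.neg
  have hfin : IsFiniteMeasure (μ.withDensity fun x => ENNReal.ofReal (f x)) :=
    isFiniteMeasure_withDensity_ofReal hf.2
  have hfin' : IsFiniteMeasure (μ.withDensity fun x => ENNReal.ofReal (-f x)) :=
    isFiniteMeasure_withDensity_ofReal hf.neg.2
  have heq : (μ.withDensity fun x => ENNReal.ofReal (f x)) =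
      μ.withDensity fun x => ENNReal.ofReal (-f x) := by
    refine ext_of_forall_mem_subalgebra_integral_eq_of_polish (𝕜 := ℝ) (A := B) ?_ ?_
    · intro x y hxy
      obtain ⟨g, hg, hne⟩ := hsep x y hxy
      refine ⟨g, ⟨g.toContinuousMap, ?_, rfl⟩, hne⟩
      exact ⟨g, hg, rfl⟩
    · intro g hg
      have hbd : ∀ u : α → ℝ, Integrable u μ → Integrable (fun x => u x * g x) μ := fun u hu =>
        hu.mul_bdd (c := ‖g‖) g.continuous.aestronglyMeasurable
          (Eventually.of_forall fun x => g.norm_coe_le_norm x)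
      rw [integral_withDensity_eq_integral_toReal_smul₀ hf.aemeasurable.ennreal_ofReal (by simp),
        integral_withDensity_eq_integral_toReal_smul₀ hneg.ennreal_ofReal
          (by simp), ← sub_eq_zero]
      simp only [ENNReal.toReal_ofReal', smul_eq_mul]
      rw [← integral_sub (hbd _ hf.pos_part) (hbd _ hf.neg_part)]
      refine Eq.trans (integral_congr_ae (Eventually.of_forall fun x => ?_)) (h g hg)
      simp only [← sub_mul]
      congr 1
      rcases le_total (f x) 0 with h0 | h0
      · rw [max_eq_right h0, max_eq_left (by linarith)]
        ring
      · rw [max_eq_left h0, max_eq_right (by linarith)]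
        ring
  have hlt : ∫⁻ x, ENNReal.ofReal (f x) ∂μ ≠ ⊤ := by
    refine ne_top_of_le_ne_top hf.2.ne (lintegral_mono fun x => ?_)
    exact Real.ofReal_le_enorm _
  filter_upwards [(withDensity_eq_iff hf.aemeasurable.ennreal_ofReal
    hneg.ennreal_ofReal hlt).1 heq] with x hx
  rcases lt_trichotomy (f x) 0 with h0 | h0 | h0
  · have h1 := ENNReal.ofReal_pos.2 (neg_pos.2 h0)
    rw [ENNReal.ofReal_of_nonpos h0.le] at hx
    exact absurd hx h1.ne
  · exact h0
  · have h1 := ENNReal.ofReal_pos.2 h0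
    rw [ENNReal.ofReal_of_nonpos (neg_nonpos.2 h0.le)] at hx
    exact absurd hx h1.ne'

end Separation

/-! ### Moments of solutions of the linearized equation -/

section Moments

variable {N : ℕ}

/-- A bounded `C²` solution of the linearized equation, with the potential written as
`N(N+2)(1+|y|²)^{-2}`. -/
structure IsLinearizedSolution (η : EuclideanSpace ℝ (Fin N) → ℝ) : Prop where
  contDiff : ContDiff ℝ 2 η
  bounded : ∃ C, ∀ y, |η y| ≤ C
  laplacian_eq : ∀ y, laplacian η y = -(N * (N + 2) * bracketPow 2 y * η y)

/-- The moment `∫ η (1+|y|²)^{-β} p`. -/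
noncomputable def moment (η : EuclideanSpace ℝ (Fin N) → ℝ) (β : ℝ)
    (p : MvPolynomial (Fin N) ℝ) : ℝ :=
  ∫ y, η y * (bracketPow β y * polyEval p y)

theorem exists_abs_bracketPow_mul_polyEval_le {p : MvPolynomial (Fin N) ℝ} {k : ℕ}
    (hp : p.IsHomogeneous k) (β : ℝ) :
    ∃ C, 0 ≤ C ∧ ∀ y : EuclideanSpace ℝ (Fin N),
      |bracketPow β y * polyEval p y| ≤ C * bracketPow (β - k / 2) y := by
  obtain ⟨C, hC0, hC⟩ := exists_abs_polyEval_le hp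
  refine ⟨C, hC0, fun y => ?_⟩
  rw [abs_mul, abs_of_pos (bracketPow_pos _ _), sub_eq_add_neg, bracketPow_add]
  calc bracketPow β y * |polyEval p y| ≤ bracketPow β y * (C * bracketPow (-((k : ℝ) / 2)) y) :=
        mul_le_mul_of_nonneg_left (hC y) (bracketPow_pos _ _).le
    _ = _ := by ring

theorem contDiff_bracketPow_mul_polyEval {n : WithTop ℕ∞} (β : ℝ) (p : MvPolynomial (Fin N) ℝ) :
    ContDiff ℝ n (fun y : EuclideanSpace ℝ (Fin N) => bracketPow β y * polyEval p y) :=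
  (contDiff_bracketPow β).mul (contDiff_polyEval p)

theorem integrable_mul_bracketPow_mul_polyEval {η : EuclideanSpace ℝ (Fin N) → ℝ}
    (hη : Continuous η) (hb : ∃ C, ∀ y, |η y| ≤ C) {p : MvPolynomial (Fin N) ℝ} {k : ℕ}
    (hp : p.IsHomogeneous k) {β : ℝ} (h : (N : ℝ) + k < 2 * β) :
    Integrable fun y => η y * (bracketPow β y * polyEval p y) := by
  obtain ⟨B, hB⟩ := hb
  obtain ⟨C, hC0, hC⟩ := exists_abs_bracketPow_mul_polyEval_le hp β
  refine ((integrable_bracketPow (N := N) (β := β - k / 2) (by linarith)).const_mul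
    (B * C)).mono' (hη.mul (contDiff_bracketPow_mul_polyEval (n := 0) β
      p).continuous).aestronglyMeasurable (Eventually.of_forall fun y => ?_)
  rw [Real.norm_eq_abs, abs_mul, mul_assoc]
  exact mul_le_mul (hB y) (hC y) (abs_nonneg _) ((abs_nonneg _).trans (hB y))

theorem polyEval_zero (y : EuclideanSpace ℝ (Fin N)) : polyEval 0 y = 0 := by simp [polyEval]

theorem integrable_mul_bracketPow_mul_polyLaplacian {η : EuclideanSpace ℝ (Fin N) → ℝ}
    (hη : Continuous η) (hb : ∃ C, ∀ y, |η y| ≤ C) {p : MvPolynomial (Fin N) ℝ} {k : ℕ}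
    (hp : p.IsHomogeneous k) {β : ℝ} (h : (N : ℝ) + k < 2 * β + 2) :
    Integrable fun y => η y * (bracketPow β y * polyEval (polyLaplacian p) y) := by
  rcases le_or_gt k 1 with hk | hk
  · simp [polyLaplacian_eq_zero hp hk, polyEval_zero]
  · refine integrable_mul_bracketPow_mul_polyEval hη hb (isHomogeneous_polyLaplacian hp) ?_
    push_cast [Nat.cast_sub (show 2 ≤ k from hk)]
    linarith

theorem exists_abs_partialDeriv_bracketPow_mul_polyEval_le {p : MvPolynomial (Fin N) ℝ} {k : ℕ}
    (hp : p.IsHomogeneous k) (β : ℝ) (i : Fin N) :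
    ∃ D, ∀ y : EuclideanSpace ℝ (Fin N),
      |partialDeriv i (fun y => bracketPow β y * polyEval p y) y| ≤
        D * bracketPow (β - k / 2 + 1 / 2) y := by
  obtain ⟨C, hC0, hC⟩ := exists_abs_bracketPow_mul_polyEval_le hp (β + 1)
  obtain ⟨D, hD⟩ : ∃ D, ∀ y : EuclideanSpace ℝ (Fin N),
      |bracketPow β y * polyEval (pderiv i p) y| ≤ D * bracketPow (β - k / 2 + 1 / 2) y := by
    rcases Nat.eq_zero_or_pos k with rfl | hk
    · refine ⟨0, fun y => ?_⟩
      rw [totalDegree_eq_zero_iff_eq_C.1 ((totalDegree_zero_iff_isHomogeneous _).2 hp), pderiv_C,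
        polyEval_zero]
      simp
    · obtain ⟨D, -, hD⟩ := exists_abs_bracketPow_mul_polyEval_le (hp.pderiv (i := i)) β
      refine ⟨D, fun y => (hD y).trans_eq ?_⟩
      rw [Nat.cast_sub hk]
      congr 2
      push_cast
      ring
  refine ⟨D + |2 * β| * C, fun y => ?_⟩
  rw [partialDeriv_mul ((contDiff_bracketPow β).differentiable one_ne_zero)
    ((contDiff_polyEval p).differentiable one_ne_zero), partialDeriv_polyEval,
    partialDeriv_bracketPow, add_mul]
  refine (abs_add_le _ _).trans (add_le_add (hD y) ?_)
  rw [show -(2 * β) * (y i * bracketPow (β + 1) y) * polyEval p y =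
    -(2 * β) * (y i * (bracketPow (β + 1) y * polyEval p y)) by ring, abs_mul, abs_neg, mul_assoc,
    abs_mul (y i)]
  refine mul_le_mul_of_nonneg_left ?_ (abs_nonneg _)
  calc |y i| * |bracketPow (β + 1) y * polyEval p y|
      ≤ bracketPow (-(1 / 2)) y * (C * bracketPow (β + 1 - k / 2) y) :=
        mul_le_mul (abs_coord_le_bracketPow y i) (hC y) (abs_nonneg _) (bracketPow_pos _ _).le
    _ = C * bracketPow (β - k / 2 + 1 / 2) y := by
        rw [← bracketPow_mul_bracketPow
          (show -(1 / 2) + (β + 1 - k / 2) = β - k / 2 + 1 / 2 by ring)]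
        ring

/-- Testing the linearized equation against `(1+|y|²)^{-β} p` with `p` homogeneous of degree `k`. -/
theorem IsLinearizedSolution.moment_recurrence {η : EuclideanSpace ℝ (Fin N) → ℝ}
    (hη : IsLinearizedSolution η) {p : MvPolynomial (Fin N) ℝ} {k : ℕ} (hp : p.IsHomogeneous k)
    {β : ℝ} (h : (N : ℝ) + k < 2 * β + 2) :
    (N * (N + 2) - 4 * β * (β + 1)) * moment η (β + 2) p
      + 4 * β * (β + 1 - N / 2 - k) * moment η (β + 1) p
      + moment η β (polyLaplacian p) = 0 := by
  have hc := hη.contDiff.continuous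
  obtain ⟨B, hB⟩ := hη.bounded
  have i2 := integrable_mul_bracketPow_mul_polyEval hc hη.bounded hp (β := β + 2) (by linarith)
  have i1 := integrable_mul_bracketPow_mul_polyEval hc hη.bounded hp (β := β + 1) (by linarith)
  have i0 := integrable_mul_bracketPow_mul_polyLaplacian hc hη.bounded hp h
  have hw : ∀ y, η y * laplacian (fun y => bracketPow β y * polyEval p y) y =
      4 * β * (β + 1 - N / 2 - k) * (η y * (bracketPow (β + 1) y * polyEval p y))
        - 4 * β * (β + 1) * (η y * (bracketPow (β + 2) y * polyEval p y))
        + η y * (bracketPow β y * polyEval (polyLaplacian p) y) := fun y => by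
    rw [laplacian_bracketPow_mul_polyEval hp]
    ring
  have hu : ∀ y, laplacian η y * (bracketPow β y * polyEval p y) =
      -(N * (N + 2)) * (η y * (bracketPow (β + 2) y * polyEval p y)) := fun y => by
    rw [hη.laplacian_eq, bracketPow_add]
    ring
  obtain ⟨C, -, hC⟩ := exists_abs_bracketPow_mul_polyEval_le hp β
  have key := integral_mul_laplacian_of_decay hη.contDiff hB
    (contDiff_bracketPow_mul_polyEval β p) hC
    (exists_abs_partialDeriv_bracketPow_mul_polyEval_le hp β) (by linarith)
    (by
      simp only [hw]
      exact ((i1.const_mul _).sub (i2.const_mul _)).add i0)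
    (by
      simp only [hu]
      exact i2.const_mul _)
  simp only [hw, hu] at key
  have i12 : Integrable fun y =>
      4 * β * (β + 1 - N / 2 - k) * (η y * (bracketPow (β + 1) y * polyEval p y))
        - 4 * β * (β + 1) * (η y * (bracketPow (β + 2) y * polyEval p y)) :=
    (i1.const_mul _).sub (i2.const_mul _)
  rw [integral_add i12 i0,
    integral_sub (i1.const_mul _) (i2.const_mul _), integral_const_mul, integral_const_mul,
    integral_const_mul] at key
  simp only [moment]
  linear_combination key

theorem moment_zero (η : EuclideanSpace ℝ (Fin N) → ℝ) (β : ℝ) : moment η β 0 = 0 := by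
  simp [moment, polyEval_zero]

theorem IsLinearizedSolution.moment_const_eq_zero {η : EuclideanSpace ℝ (Fin N) → ℝ}
    (hN : 3 ≤ N) (hη : IsLinearizedSolution η) {p : MvPolynomial (Fin N) ℝ}
    (hp : p.IsHomogeneous 0) : moment η ((N : ℝ) / 2 + 1) p = 0 := by
  have hN' : (3 : ℝ) ≤ N := by exact_mod_cast hN
  have h := hη.moment_recurrence hp (β := (N : ℝ) / 2) (by push_cast; linarith)
  rw [polyLaplacian_eq_zero hp zero_le_one, moment_zero] at h
  have h2 : (2 * N : ℝ) * moment η ((N : ℝ) / 2 + 1) p = 0 := by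
    push_cast at h
    linear_combination h
  exact (mul_eq_zero.1 h2).resolve_left (by positivity)

/-- If the moments of a solution against `(1+|y|²)^{-N/2-2} p` vanish for `p` of degree at most one,
then all its moments vanish. -/
theorem IsLinearizedSolution.moment_eq_zero {η : EuclideanSpace ℝ (Fin N) → ℝ}
    (hN : 3 ≤ N) (hη : IsLinearizedSolution η)
    (h1 : ∀ k ≤ 1, ∀ p : MvPolynomial (Fin N) ℝ, p.IsHomogeneous k →
      moment η ((N : ℝ) / 2 + 2) p = 0) (m : ℕ) :
    ∀ k ≤ m, ∀ p : MvPolynomial (Fin N) ℝ, p.IsHomogeneous k →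
      moment η ((N : ℝ) / 2 + 1 + m) p = 0 := by
  have hN' : (3 : ℝ) ≤ N := by exact_mod_cast hN
  induction m using Nat.strong_induction_on with
  | _ m ih =>
    intro k hk p hp
    match m, ih, hk with
    | 0, _, hk =>
      obtain rfl : k = 0 := by omega
      rw [Nat.cast_zero, add_zero]
      exact hη.moment_const_eq_zero hN hp
    | 1, _, hk =>
      have h := h1 k hk p hp
      rwa [show (N : ℝ) / 2 + 2 = N / 2 + 1 + (1 : ℕ) by push_cast; ring] at h
    | m + 2, ih, hk =>
      have hk' : (k : ℝ) ≤ m + 2 := by exact_mod_cast hk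
      have h := hη.moment_recurrence hp (β := (N : ℝ) / 2 + 1 + m) (by
        have : (0 : ℝ) ≤ m := Nat.cast_nonneg m
        linarith)
      have hlap : moment η ((N : ℝ) / 2 + 1 + m) (polyLaplacian p) = 0 :=
        ih m (by omega) (k - 2) (by omega) _ (isHomogeneous_polyLaplacian hp)
      have hmid : ((N : ℝ) / 2 + 1 + m + 1 - N / 2 - k) *
          moment η ((N : ℝ) / 2 + 1 + m + 1) p = 0 := by
        rcases hk.eq_or_lt with rfl | hlt
        · push_cast
          ring
        · rw [show (N : ℝ) / 2 + 1 + m + 1 = N / 2 + 1 + (m + 1 : ℕ) by push_cast; ring,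
            ih (m + 1) (by omega) k (by omega) p hp, mul_zero]
      rw [hlap] at h
      have h2 : -(4 * (m + 1) * (N + m + 2) : ℝ) *
          moment η ((N : ℝ) / 2 + 1 + (m + 2 : ℕ)) p = 0 := by
        rw [show (N : ℝ) / 2 + 1 + (m + 2 : ℕ) = N / 2 + 1 + m + 2 by push_cast; ring]
        linear_combination h - 4 * ((N : ℝ) / 2 + 1 + m) * hmid
      exact (mul_eq_zero.1 h2).resolve_left (neg_ne_zero.2 (by positivity))

end Moments

/-! ### Vanishing of solutions with vanishing moments -/

section Vanishing

open scoped BoundedContinuousFunction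

variable {N : ℕ}

/-- The bounded functions `(1+|y|²)^{-m} p` with `p` homogeneous of degree at most `m`. -/
noncomputable def bracketPolySubmonoid (N : ℕ) : Submonoid (EuclideanSpace ℝ (Fin N) →ᵇ ℝ) where
  carrier := {g | ∃ (m k : ℕ) (p : MvPolynomial (Fin N) ℝ), k ≤ m ∧ p.IsHomogeneous k ∧
    ∀ y, g y = bracketPow m y * polyEval p y}
  one_mem' := ⟨0, 0, 1, le_rfl, isHomogeneous_one _ _, fun y => by
    simp [polyEval, bracketPow_zero]⟩
  mul_mem' := by
    rintro f g ⟨m, k, p, hk, hp, hf⟩ ⟨m', k', p', hk', hp', hg⟩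
    refine ⟨m + m', k + k', p * p', add_le_add hk hk', hp.mul hp', fun y => ?_⟩
    rw [BoundedContinuousFunction.mul_apply, hf, hg, Nat.cast_add, bracketPow_add]
    simp only [polyEval, map_mul]
    ring

theorem exists_mem_bracketPolySubmonoid {m k : ℕ} (hk : k ≤ m) {p : MvPolynomial (Fin N) ℝ}
    (hp : p.IsHomogeneous k) :
    ∃ g ∈ bracketPolySubmonoid N, ∀ y, g y = bracketPow m y * polyEval p y := by
  obtain ⟨C, hC0, hC⟩ := exists_abs_bracketPow_mul_polyEval_le hp m
  have hk' : (k : ℝ) ≤ m := by exact_mod_cast hk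
  refine ⟨BoundedContinuousFunction.ofNormedAddCommGroup
    (fun y => bracketPow m y * polyEval p y)
    (contDiff_bracketPow_mul_polyEval (n := 0) m p).continuous C fun y => ?_,
    ⟨m, k, p, hk, hp, fun y => rfl⟩, fun y => rfl⟩
  refine (hC y).trans (mul_le_of_le_one_right hC0 (bracketPow_le_one ?_ y))
  have : (0 : ℝ) ≤ k := Nat.cast_nonneg k
  linarith

theorem exists_mem_bracketPolySubmonoid_ne {x y : EuclideanSpace ℝ (Fin N)} (hxy : x ≠ y) :
    ∃ g ∈ bracketPolySubmonoid N, g x ≠ g y := by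
  by_contra! h
  obtain ⟨g, hg, hg1⟩ := exists_mem_bracketPolySubmonoid (N := N) zero_le_one
    (isHomogeneous_one _ _)
  have h1 : bracketPow 1 x = bracketPow 1 y := by
    simpa [hg1, polyEval] using h g hg
  refine hxy (PiLp.ext fun i => ?_)
  obtain ⟨f, hf, hf1⟩ := exists_mem_bracketPolySubmonoid (N := N) le_rfl (isHomogeneous_X ℝ i)
  have h2 : bracketPow 1 x * x i = bracketPow 1 y * y i := by
    simpa [hf1, polyEval] using h f hf
  rw [h1] at h2
  exact mul_left_cancel₀ (bracketPow_pos _ _).ne' h2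

theorem eq_zero_of_forall_moment_eq_zero {η : EuclideanSpace ℝ (Fin N) → ℝ} (hc : Continuous η)
    (hb : ∃ C, ∀ y, |η y| ≤ C)
    (h : ∀ m : ℕ, ∀ k ≤ m, ∀ p : MvPolynomial (Fin N) ℝ, p.IsHomogeneous k →
      moment η ((N : ℝ) / 2 + 1 + m) p = 0) (y : EuclideanSpace ℝ (Fin N)) : η y = 0 := by
  have h_int : Integrable fun y => η y * bracketPow ((N : ℝ) / 2 + 1) y := by
    have := integrable_mul_bracketPow_mul_polyEval hc hb (isHomogeneous_one (Fin N) ℝ)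
      (β := (N : ℝ) / 2 + 1) (by push_cast; linarith)
    simpa [polyEval] using this
  have hmul : ∀ g : EuclideanSpace ℝ (Fin N) →ᵇ ℝ,
      Integrable fun y => η y * bracketPow ((N : ℝ) / 2 + 1) y * g y := fun g =>
    h_int.mul_bdd (c := ‖g‖) g.continuous.aestronglyMeasurable
      (Eventually.of_forall fun x => g.norm_coe_le_norm x)
  have hae := ae_eq_zero_of_forall_mem_subalgebra_integral_mul_eq_zero h_int
    (Algebra.adjoin ℝ (bracketPolySubmonoid N : Set (EuclideanSpace ℝ (Fin N) →ᵇ ℝ)))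
    (fun x y hxy => by
      obtain ⟨g, hg, hne⟩ := exists_mem_bracketPolySubmonoid_ne hxy
      exact ⟨g, Algebra.subset_adjoin hg, hne⟩)
    (fun g hg => by
      rw [← Subalgebra.mem_toSubmodule, Algebra.adjoin_eq_span, Submonoid.closure_eq] at hg
      induction hg using Submodule.span_induction with
      | mem g hg =>
        obtain ⟨m, k, p, hk, hp, hg⟩ := hg
        rw [← h m k hk p hp, moment]
        refine integral_congr_ae (Eventually.of_forall fun y => ?_)
        simp only [hg, bracketPow_add (_ + 1)]
        ring
      | zero => simp
      | add f g _ _ hf hg =>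
        simp only [BoundedContinuousFunction.add_apply, mul_add]
        rw [integral_add (hmul f) (hmul g), hf, hg, add_zero]
      | smul a g _ hg =>
        simp only [BoundedContinuousFunction.smul_apply, smul_eq_mul, mul_left_comm _ a]
        rw [integral_const_mul, hg, mul_zero])
  have hcont : Continuous fun y => η y * bracketPow ((N : ℝ) / 2 + 1) y :=
    hc.mul (contDiff_bracketPow (n := 0) _).continuous
  have h0 := congrFun ((hcont.ae_eq_iff_eq volume continuous_const).1 hae) y
  exact (mul_eq_zero.1 h0).resolve_right (bracketPow_pos _ _).ne'

end Vanishing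

/-! ### The explicit solutions -/

section Kernel

variable {N : ℕ}

/-- The space of bounded solutions of the linearized equation. -/
def linearizedKernel (N : ℕ) : Submodule ℝ (EuclideanSpace ℝ (Fin N) → ℝ) where
  carrier := {η | IsLinearizedSolution η}
  zero_mem' :=
    { contDiff := contDiff_const
      bounded := ⟨0, fun y => by simp⟩
      laplacian_eq := fun y => by
        have h := laplacian_const_mul (N := N) (f := fun _ => 0) contDiff_const 0 y
        simp only [zero_mul] at h
        rw [Pi.zero_apply, mul_zero, neg_zero]
        exact h }
  add_mem' := fun {f g} hf hg =>
    { contDiff := hf.contDiff.add hg.contDiff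
      bounded := by
        obtain ⟨B, hB⟩ := hf.bounded
        obtain ⟨C, hC⟩ := hg.bounded
        exact ⟨B + C, fun y => (abs_add_le _ _).trans (add_le_add (hB y) (hC y))⟩
      laplacian_eq := fun y => by
        refine (laplacian_add hf.contDiff hg.contDiff y).trans ?_
        rw [hf.laplacian_eq, hg.laplacian_eq, Pi.add_apply]
        ring }
  smul_mem' := fun c f hf =>
    { contDiff := hf.contDiff.const_smul c
      bounded := by
        obtain ⟨B, hB⟩ := hf.bounded
        refine ⟨|c| * B, fun y => ?_⟩
        rw [Pi.smul_apply, smul_eq_mul, abs_mul]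
        exact mul_le_mul_of_nonneg_left (hB y) (abs_nonneg c)
      laplacian_eq := fun y => by
        refine (laplacian_const_mul hf.contDiff c y).trans ?_
        rw [hf.laplacian_eq, Pi.smul_apply, smul_eq_mul]
        ring }

/-- The functions `ψ₀` (index `none`) and `ψ_i` (index `some i`), up to normalization. -/
noncomputable def kernelFun : Option (Fin N) → EuclideanSpace ℝ (Fin N) → ℝ
  | none => fun y => 2 * bracketPow ((N : ℝ) / 2) y + -1 * bracketPow ((N : ℝ) / 2 - 1) y
  | some i => fun y => bracketPow ((N : ℝ) / 2) y * polyEval (X i) y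

theorem contDiff_kernelFun {n : WithTop ℕ∞} (a : Option (Fin N)) :
    ContDiff ℝ n (kernelFun a : EuclideanSpace ℝ (Fin N) → ℝ) := by
  match a with
  | none =>
    exact (contDiff_const.mul (contDiff_bracketPow _)).add
      (contDiff_const.mul (contDiff_bracketPow _))
  | some i => exact contDiff_bracketPow_mul_polyEval _ _

theorem exists_abs_kernelFun_le (a : Option (Fin N)) :
    ∃ C, 0 ≤ C ∧ ∀ y : EuclideanSpace ℝ (Fin N),
      |kernelFun a y| ≤ C * bracketPow ((N : ℝ) / 2 - 1) y := by
  match a with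
  | none =>
    refine ⟨3, by norm_num, fun y => ?_⟩
    have h := bracketPow_le (show (N : ℝ) / 2 - 1 ≤ N / 2 by linarith) y
    have h1 := bracketPow_pos ((N : ℝ) / 2) y
    rw [kernelFun, abs_le]
    constructor <;> linarith
  | some i =>
    obtain ⟨C, hC0, hC⟩ := exists_abs_bracketPow_mul_polyEval_le (isHomogeneous_X ℝ i)
      ((N : ℝ) / 2)
    refine ⟨C, hC0, fun y => (hC y).trans (mul_le_mul_of_nonneg_left (bracketPow_le ?_ y) hC0)⟩
    push_cast
    linarith

theorem kernelFun_mem_linearizedKernel (hN : 3 ≤ N) (a : Option (Fin N)) :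
    kernelFun a ∈ linearizedKernel N where
  contDiff := contDiff_kernelFun a
  bounded := by
    have hN' : (3 : ℝ) ≤ N := by exact_mod_cast hN
    obtain ⟨C, hC0, hC⟩ := exists_abs_kernelFun_le a
    exact ⟨C, fun y => (hC y).trans
      (mul_le_of_le_one_right hC0 (bracketPow_le_one (by linarith) y))⟩
  laplacian_eq := fun y => by
    match a with
    | none =>
      have h := laplacian_add (contDiff_const.mul (contDiff_bracketPow ((N : ℝ) / 2)))
        (contDiff_const.mul (contDiff_bracketPow ((N : ℝ) / 2 - 1))) y (f := fun y => 2 * _)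
        (g := fun y => -1 * _)
      refine h.trans ?_
      rw [laplacian_const_mul (contDiff_bracketPow _), laplacian_const_mul (contDiff_bracketPow _),
        laplacian_bracketPow, laplacian_bracketPow, kernelFun,
        show (N : ℝ) / 2 - 1 + 2 = 2 + (N / 2 - 1) by ring,
        show (N : ℝ) / 2 - 1 + 1 = N / 2 by ring, add_comm ((N : ℝ) / 2) 2,
        ← bracketPow_mul_bracketPow (show 2 + ((N : ℝ) / 2 - 1) = N / 2 + 1 by ring),
        bracketPow_add 2, bracketPow_add 2]
      ring
    | some i =>
      refine (laplacian_bracketPow_mul_polyEval (isHomogeneous_X ℝ i) _ y).trans ?_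
      rw [polyLaplacian_eq_zero (isHomogeneous_X ℝ i) le_rfl, polyEval_zero, kernelFun,
        bracketPow_add _ 2]
      push_cast
      ring

theorem integrable_mul_kernelFun {η : EuclideanSpace ℝ (Fin N) → ℝ} (hη : Continuous η)
    (hb : ∃ C, ∀ y, |η y| ≤ C) (a : Option (Fin N)) :
    Integrable fun y => η y * (kernelFun a y * bracketPow 2 y) := by
  obtain ⟨B, hB⟩ := hb
  obtain ⟨C, hC0, hC⟩ := exists_abs_kernelFun_le (N := N) a
  refine ((integrable_bracketPow (N := N) (β := (N : ℝ) / 2 + 1) (by linarith)).const_mul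
    (B * C)).mono' (hη.mul ((contDiff_kernelFun (n := 0) a).continuous.mul
      (contDiff_bracketPow (n := 0) 2).continuous)).aestronglyMeasurable
      (Eventually.of_forall fun y => ?_)
  rw [Real.norm_eq_abs, abs_mul, abs_mul, abs_of_pos (bracketPow_pos 2 y),
    ← bracketPow_mul_bracketPow (show (N : ℝ) / 2 - 1 + 2 = N / 2 + 1 by ring), mul_assoc B,
    ← mul_assoc C]
  exact mul_le_mul (hB y) (mul_le_mul_of_nonneg_right (hC y) (bracketPow_pos _ _).le)
    (mul_nonneg (abs_nonneg _) (bracketPow_pos _ _).le) ((abs_nonneg _).trans (hB y))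

theorem kernelFun_linearIndependent {c : Option (Fin N) → ℝ}
    (h : ∀ y : EuclideanSpace ℝ (Fin N), ∑ a, c a * kernelFun a y = 0) : c = 0 := by
  have h0 : c none = 0 := by
    have := h 0
    norm_num [Fintype.sum_option, kernelFun, polyEval, bracketPow] at this
    exact this
  funext a
  match a with
  | none => exact h0
  | some i =>
    have := h (EuclideanSpace.single i 1)
    simpa [Fintype.sum_option, kernelFun, polyEval, h0, Pi.single_apply,
      (bracketPow_pos _ _).ne'] using this

/-- The Gram matrix of the explicit solutions in `L²((1+|y|²)^{-2} dy)`. -/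
noncomputable def kernelGram (N : ℕ) : Matrix (Option (Fin N)) (Option (Fin N)) ℝ :=
  Matrix.of fun b a => ∫ y, kernelFun a y * (kernelFun b y * bracketPow 2 y)

theorem kernelGram_mulVec (hN : 3 ≤ N) (c : Option (Fin N) → ℝ) (b : Option (Fin N)) :
    (kernelGram N).mulVec c b =
      ∫ y, (∑ a, c a * kernelFun a y) * (kernelFun b y * bracketPow 2 y) := by
  simp only [Finset.sum_mul, mul_assoc]
  rw [integral_finsetSum]
  · simp only [integral_const_mul, Matrix.mulVec, dotProduct, kernelGram, Matrix.of_apply]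
    exact Finset.sum_congr rfl fun a _ => mul_comm _ _
  · intro a _
    have h := kernelFun_mem_linearizedKernel hN a
    exact (integrable_mul_kernelFun h.contDiff.continuous h.bounded b).const_mul _

theorem sum_kernelFun_mem_linearizedKernel (hN : 3 ≤ N) (c : Option (Fin N) → ℝ) :
    (fun y => ∑ a, c a * kernelFun a y) ∈ linearizedKernel N := by
  have h := Submodule.sum_mem (linearizedKernel N) (t := Finset.univ) fun a _ =>
    Submodule.smul_mem _ (c a) (kernelFun_mem_linearizedKernel hN a)
  convert h using 1
  funext y
  simp

theorem kernelGram_mulVec_injective (hN : 3 ≤ N) :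
    Function.Injective (kernelGram N).mulVecLin := by
  rw [← LinearMap.ker_eq_bot, LinearMap.ker_eq_bot']
  intro c hc
  have hS := sum_kernelFun_mem_linearizedKernel hN c
  set S : EuclideanSpace ℝ (Fin N) → ℝ := fun y => ∑ a, c a * kernelFun a y with hSdef
  have hSc : Continuous S := hS.contDiff.continuous
  have hexp : ∀ y, S y * S y * bracketPow 2 y =
      ∑ b, c b * (S y * (kernelFun b y * bracketPow 2 y)) := fun y => by
    nth_rewrite 2 [hSdef]
    simp only [Finset.mul_sum, Finset.sum_mul]
    exact Finset.sum_congr rfl fun b _ => by ring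
  have hi : ∀ b, Integrable fun y => c b * (S y * (kernelFun b y * bracketPow 2 y)) := fun b =>
    (integrable_mul_kernelFun hSc hS.bounded b).const_mul _
  have hzero : ∫ y, S y * S y * bracketPow 2 y = 0 := by
    simp only [hexp]
    rw [integral_finsetSum _ fun b _ => hi b]
    refine Finset.sum_eq_zero fun b _ => ?_
    rw [integral_const_mul, ← kernelGram_mulVec hN c b]
    have := congrFun hc b
    rw [Matrix.mulVecLin_apply] at this
    simp [this]
  have h_int : Integrable fun y => S y * S y * bracketPow 2 y := by
    simp only [hexp]
    exact integrable_finsetSum _ fun b _ => hi b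
  have hcont : Continuous fun y => S y * S y * bracketPow 2 y :=
    (hSc.mul hSc).mul (contDiff_bracketPow (n := 0) 2).continuous
  have hae := (integral_eq_zero_iff_of_nonneg
    (fun y => mul_nonneg (mul_self_nonneg _) (bracketPow_pos 2 y).le) h_int).1 hzero
  refine kernelFun_linearIndependent fun y => ?_
  have h0 := congrFun ((hcont.ae_eq_iff_eq volume continuous_const).1 hae) y
  exact mul_self_eq_zero.1 ((mul_eq_zero.1 h0).resolve_right (ne_of_gt (bracketPow_pos 2 y)))

/-- A solution orthogonal to the explicit solutions vanishes. -/
theorem eq_zero_of_forall_integral_mul_kernelFun_eq_zero (hN : 3 ≤ N)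
    {η : EuclideanSpace ℝ (Fin N) → ℝ} (hη : IsLinearizedSolution η)
    (h : ∀ a, ∫ y, η y * (kernelFun a y * bracketPow 2 y) = 0) (y : EuclideanSpace ℝ (Fin N)) :
    η y = 0 := by
  have hc := hη.contDiff.continuous
  have hX : ∀ i, moment η ((N : ℝ) / 2 + 2) (X i) = 0 := fun i => by
    rw [← h (some i), moment]
    simp only [kernelFun, bracketPow_add _ 2, mul_right_comm]
  have hone : moment η ((N : ℝ) / 2 + 2) 1 = 0 := by
    have h1 := hη.moment_const_eq_zero hN (isHomogeneous_one _ _)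
    have h2 := h none
    have i2 := integrable_mul_bracketPow_mul_polyEval hc hη.bounded
      (isHomogeneous_one (Fin N) ℝ) (β := (N : ℝ) / 2 + 2) (by push_cast; linarith)
    have i1 := integrable_mul_bracketPow_mul_polyEval hc hη.bounded
      (isHomogeneous_one (Fin N) ℝ) (β := (N : ℝ) / 2 + 1) (by push_cast; linarith)
    have hexp : ∀ y, η y * (kernelFun none y * bracketPow 2 y) =
        2 * (η y * (bracketPow ((N : ℝ) / 2 + 2) y * polyEval 1 y)) -
          η y * (bracketPow ((N : ℝ) / 2 + 1) y * polyEval 1 y) := fun y => by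
      rw [kernelFun, bracketPow_add _ 2,
        ← bracketPow_mul_bracketPow (show (N : ℝ) / 2 - 1 + 2 = N / 2 + 1 by ring)]
      simp only [polyEval, map_one]
      ring
    simp only [hexp] at h2
    rw [integral_sub (i2.const_mul 2) i1, integral_const_mul] at h2
    simp only [moment] at h1 ⊢
    linarith
  refine eq_zero_of_forall_moment_eq_zero hc hη.bounded
    (fun m => hη.moment_eq_zero hN (fun k hk p hp => ?_) m) y
  have hconst : ∀ q : MvPolynomial (Fin N) ℝ, q.IsHomogeneous 0 → ∃ a, q = C a := fun q hq =>
    ⟨_, totalDegree_eq_zero_iff_eq_C.1 ((totalDegree_zero_iff_isHomogeneous _).2 hq)⟩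
  rcases Nat.le_one_iff_eq_zero_or_eq_one.1 hk with rfl | rfl
  · obtain ⟨a, rfl⟩ := hconst p hp
    have : moment η ((N : ℝ) / 2 + 2) (C a) = a * moment η ((N : ℝ) / 2 + 2) 1 := by
      rw [moment, moment, ← integral_const_mul]
      refine integral_congr_ae (Eventually.of_forall fun y => ?_)
      simp only [polyEval, map_one, eval_C]
      ring
    rw [this, hone, mul_zero]
  · choose a ha using fun i => hconst (pderiv i p) (hp.pderiv (i := i))
    have hexp : ∀ y, η y * (bracketPow ((N : ℝ) / 2 + 2) y * polyEval p y) =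
        ∑ i, a i * (η y * (bracketPow ((N : ℝ) / 2 + 2) y * polyEval (X i) y)) := fun y => by
      have he := sum_coord_mul_partialDeriv_polyEval hp y
      rw [Nat.cast_one, one_mul] at he
      rw [← he, Finset.mul_sum, Finset.mul_sum]
      refine Finset.sum_congr rfl fun i _ => ?_
      rw [partialDeriv_polyEval, ha]
      simp only [polyEval, eval_C, eval_X]
      ring
    simp only [moment, hexp]
    rw [integral_finsetSum _ fun i _ => (integrable_mul_bracketPow_mul_polyEval hc hη.bounded
      (isHomogeneous_X ℝ i) (by push_cast; linarith)).const_mul _]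
    refine Finset.sum_eq_zero fun i _ => ?_
    rw [integral_const_mul]
    exact mul_eq_zero_of_right _ (hX i)

/-- Every bounded solution is a combination of the explicit ones. -/
theorem IsLinearizedSolution.exists_eq_sum_kernelFun (hN : 3 ≤ N)
    {ξ : EuclideanSpace ℝ (Fin N) → ℝ} (hξ : IsLinearizedSolution ξ) :
    ∃ c : Option (Fin N) → ℝ, ∀ y, ξ y = ∑ a, c a * kernelFun a y := by
  obtain ⟨c, hc⟩ := LinearMap.surjective_of_injective (kernelGram_mulVec_injective hN)
    fun b => ∫ y, ξ y * (kernelFun b y * bracketPow 2 y)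
  have hS := sum_kernelFun_mem_linearizedKernel hN c
  refine ⟨c, fun y => sub_eq_zero.1 ?_⟩
  refine eq_zero_of_forall_integral_mul_kernelFun_eq_zero hN
    (η := ξ - fun y => ∑ a, c a * kernelFun a y)
    (Submodule.sub_mem (linearizedKernel N) hξ hS) (fun b => ?_) y
  have hb := congrFun hc b
  rw [Matrix.mulVecLin_apply, kernelGram_mulVec hN] at hb
  simp only [Pi.sub_apply, sub_mul]
  rw [integral_sub (integrable_mul_kernelFun hξ.contDiff.continuous hξ.bounded b)
    (integrable_mul_kernelFun hS.contDiff.continuous hS.bounded b), hb, sub_self]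

end Kernel

section Bubble

variable {N : ℕ}

theorem bubbleConst_pos (hN : 3 ≤ N) : 0 < bubbleConst N := by
  have hN' : (3 : ℝ) ≤ N := by exact_mod_cast hN
  exact rpow_pos_of_pos (mul_pos (by linarith) (by linarith)) _

theorem U01_rpow (hN : 3 ≤ N) (y : EuclideanSpace ℝ (Fin N)) :
    U01 N y ^ ((4 : ℝ) / ((N : ℝ) - 2)) = N * (N - 2) * bracketPow 2 y := by
  have hN' : (3 : ℝ) ≤ N := by exact_mod_cast hN
  have h2 : (N : ℝ) - 2 ≠ 0 := by linarith
  have hpos : (0 : ℝ) < N * (N - 2) := mul_pos (by linarith) (by linarith)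
  have hy := one_add_norm_sq_pos y
  rw [U01, mul_rpow (bubbleConst_pos hN).le (rpow_pos_of_pos hy _).le, bubbleConst,
    ← rpow_mul hpos.le, ← rpow_mul hy.le, bracketPow]
  rw [show ((N : ℝ) - 2) / 4 * (4 / (N - 2)) = 1 by field_simp,
    show -(((N : ℝ) - 2) / 2) * (4 / (N - 2)) = -2 by field_simp; norm_num, rpow_one]

theorem psi0_eq (y : EuclideanSpace ℝ (Fin N)) :
    psi0 N y = ((N : ℝ) - 2) / 2 * bubbleConst N * kernelFun none y := by
  have h : bracketPow ((N : ℝ) / 2 - 1) y = bracketPow ((N : ℝ) / 2) y * (1 + ‖y‖ ^ 2) := by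
    rw [← bracketPow_mul_bracketPow (show (N : ℝ) / 2 - 1 + 1 = N / 2 by ring), mul_assoc,
      bracketPow_one_mul, mul_one]
  simp only [kernelFun, h, psi0]
  rw [bracketPow]
  ring

theorem psii_eq (i : Fin N) (y : EuclideanSpace ℝ (Fin N)) :
    psii N i y = ((N : ℝ) - 2) * bubbleConst N * kernelFun (some i) y := by
  simp only [psii, kernelFun, bracketPow, polyEval, eval_X]
  ring

end Bubble

/-- Nondegeneracy of the standard bubble: every bounded `C²` solution of the linearized
equation `-Δξ = ((N+2)/(N-2)) U_{0,1}^{4/(N-2)} ξ` on `ℝ^N` is a linear combination of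
`ψ₀, ψ₁, …, ψ_N`. -/
theorem bubble_nondegeneracy {N : ℕ} (hN : 3 ≤ N)
    (ξ : EuclideanSpace ℝ (Fin N) → ℝ) (hξ : ContDiff ℝ 2 ξ)
    (hbdd : ∃ C : ℝ, ∀ y, |ξ y| ≤ C)
    (hpde : ∀ y, -laplacian ξ y
      = (((N : ℝ) + 2) / ((N : ℝ) - 2)) * U01 N y ^ ((4 : ℝ) / ((N : ℝ) - 2)) * ξ y) :
    ∃ (c₀ : ℝ) (c : Fin N → ℝ),
      ξ = fun y => c₀ * psi0 N y + ∑ i : Fin N, c i * psii N i y := by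
  have hN' : (3 : ℝ) ≤ N := by exact_mod_cast hN
  have h2 : (N : ℝ) - 2 ≠ 0 := by linarith
  have hsol : IsLinearizedSolution ξ := ⟨hξ, hbdd, fun y => by
    have h := hpde y
    rw [U01_rpow hN] at h
    field_simp at h
    linarith⟩
  obtain ⟨c, hc⟩ := hsol.exists_eq_sum_kernelFun hN
  have hC := (bubbleConst_pos hN).ne'
  refine ⟨c none / (((N : ℝ) - 2) / 2 * bubbleConst N),
    fun i => c (some i) / (((N : ℝ) - 2) * bubbleConst N), funext fun y => ?_⟩
  simp only [hc y, Fintype.sum_option, psi0_eq, psii_eq]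
  congr 1
  · field_simp
  · exact Finset.sum_congr rfl fun i _ => by field_simp
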